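/- For n ≥ 3, whenever SL(n,ℤ) acts by isometries on a complete CAT(0) space X and some elementary matrix has a fixed point in X, the whole group SL(n,ℤ) has a fixed point in X. -/

import Mathlib

/-- A geodesic segment from `x` to `y`, parameterized proportionally to arc length on `[0,1]`. -/
def IsGeodesicSeg {X : Type*} [MetricSpace X] (x y : X) (γ : ℝ → X) : Prop :=
  γ 0 = x ∧ γ 1 = y ∧
    ∀ s ∈ Set.Icc (0:ℝ) 1, ∀ t ∈ Set.Icc (0:ℝ) 1, dist (γ s) (γ t) = |s - t| * dist x y

/-- A CAT(0) space: a geodesic metric space satisfying the CN (Bruhat–Tits comparison)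
inequality, which for geodesic spaces is equivalent to the CAT(0) comparison-triangle
condition. -/
class CAT0Space (X : Type*) [MetricSpace X] : Prop where
  geodesic : ∀ x y : X, ∃ γ : ℝ → X, IsGeodesicSeg x y γ
  cn : ∀ x y z m : X, dist y m = dist y z / 2 → dist z m = dist y z / 2 →
    dist x m ^ 2 ≤ (dist x y ^ 2 + dist x z ^ 2) / 2 - dist y z ^ 2 / 4

/-- The elementary matrix E_{ij} = I_n + U_{ij} in SL(n, ℤ). -/
def elemMat {n : ℕ} (i j : Fin n) (h : i ≠ j) : Matrix.SpecialLinearGroup (Fin n) ℤ :=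
  ⟨Matrix.transvection i j 1, by simp [Matrix.det_transvection_of_ne i j h (1 : ℤ)]⟩

set_option linter.all false
set_option linter.unusedSimpArgs false
set_option linter.unreachableTactic false
set_option linter.unusedTactic false

namespace SLBG

open Matrix

/-- `W k M`: the matrix `M` is a product of at most `k` integer transvections. -/
def W {ι : Type*} [Fintype ι] [DecidableEq ι] (k : ℕ) (M : Matrix ι ι ℤ) : Prop :=
  ∃ L : List (TransvectionStruct ι ℤ), L.length ≤ k ∧
    M = (L.map TransvectionStruct.toMatrix).prod

section basics

variable {ι : Type*} [Fintype ι] [DecidableEq ι]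

lemma W.mono {k l : ℕ} {M : Matrix ι ι ℤ} (h : W k M) (hkl : k ≤ l) : W l M := by
  obtain ⟨L, hL, rfl⟩ := h
  exact ⟨L, hL.trans hkl, rfl⟩

lemma W.one (k : ℕ) : W k (1 : Matrix ι ι ℤ) := ⟨[], by simp, by simp⟩

lemma W.mul {k l : ℕ} {M N : Matrix ι ι ℤ} (hM : W k M) (hN : W l N) : W (k + l) (M * N) := by
  obtain ⟨L, hL, rfl⟩ := hM
  obtain ⟨L', hL', rfl⟩ := hN
  exact ⟨L ++ L', by simp; omega, by simp⟩

lemma W.transv {i j : ι} (h : i ≠ j) (c : ℤ) : W 1 (transvection i j c) :=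
  ⟨[⟨i, j, h, c⟩], by simp, by simp⟩

lemma W.det {k : ℕ} {M : Matrix ι ι ℤ} (h : W k M) : M.det = 1 := by
  obtain ⟨L, hL, rfl⟩ := h
  simp

lemma W.exists_inv {k : ℕ} {M : Matrix ι ι ℤ} (h : W k M) :
    ∃ M' : Matrix ι ι ℤ, W k M' ∧ M' * M = 1 ∧ M * M' = 1 := by
  obtain ⟨L, hL, rfl⟩ := h
  refine ⟨(L.reverse.map (TransvectionStruct.toMatrix ∘ TransvectionStruct.inv)).prod,
    ⟨L.reverse.map TransvectionStruct.inv, by simpa using hL, by simp⟩,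
    TransvectionStruct.reverse_inv_prod_mul_prod L,
    TransvectionStruct.prod_mul_reverse_inv_prod L⟩

lemma W.of_mul_left {k l : ℕ} {M N : Matrix ι ι ℤ} (hM : W k M) (h : W l (M * N)) :
    W (k + l) N := by
  obtain ⟨M', h1, h2, h3⟩ := hM.exists_inv
  have := h1.mul h
  rwa [← Matrix.mul_assoc, h2, Matrix.one_mul] at this

lemma W.of_mul_right {k l : ℕ} {M N : Matrix ι ι ℤ} (hM : W k M) (h : W l (N * M)) :
    W (l + k) N := by
  obtain ⟨M', h1, h2, h3⟩ := hM.exists_inv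
  have := h.mul h1
  rwa [Matrix.mul_assoc, h3, Matrix.mul_one] at this

lemma W.transpose {k : ℕ} {M : Matrix ι ι ℤ} (h : W k M) : W k Mᵀ := by
  obtain ⟨L, hL, rfl⟩ := h
  refine ⟨(L.map (fun t => (⟨t.j, t.i, t.hij.symm, t.c⟩ : TransvectionStruct ι ℤ))).reverse,
    by simpa using hL, ?_⟩
  rw [Matrix.transpose_list_prod]
  congr 1
  simp only [List.map_map, List.map_reverse]
  congr 2
  funext t
  simp [TransvectionStruct.toMatrix, transvection]

lemma W.reindex {κ : Type*} [Fintype κ] [DecidableEq κ] (e : ι ≃ κ) {k : ℕ} {M : Matrix ι ι ℤ}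
    (h : W k M) : W k (reindexAlgEquiv ℤ ℤ e M) := by
  obtain ⟨L, hL, rfl⟩ := h
  refine ⟨L.map (TransvectionStruct.reindexEquiv e), by simpa using hL, ?_⟩
  rw [← TransvectionStruct.toMatrix_reindexEquiv_prod]
  simp

lemma W.sumInl {κ : Type*} [Fintype κ] [DecidableEq κ] {k : ℕ} {M : Matrix ι ι ℤ}
    (h : W k M) : W k (fromBlocks M 0 0 (1 : Matrix κ κ ℤ)) := by
  obtain ⟨L, hL, rfl⟩ := h
  refine ⟨L.map (TransvectionStruct.sumInl κ), by simpa using hL, ?_⟩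
  have := TransvectionStruct.sumInl_toMatrix_prod_mul κ (1 : Matrix ι ι ℤ) L (1 : Matrix κ κ ℤ)
  rw [fromBlocks_one, Matrix.mul_one, Matrix.mul_one] at this
  rw [← this]
  simp

lemma W.rowadd_aux (q : ι) (s : ι → ℤ) (F : Finset ι) (hF : q ∉ F) :
    W F.card (1 + ∑ i ∈ F, Matrix.single q i (s i)) := by
  classical
  induction F using Finset.induction_on with
  | empty => simpa using W.one 0
  | insert a F ha ih =>
    have hq : q ∉ F := fun h => hF (Finset.mem_insert_of_mem h)
    have hqa : q ≠ a := fun h => hF (h ▸ Finset.mem_insert_self _ _)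
    have := (ih hq).mul (W.transv hqa (s a))
    rw [Finset.card_insert_of_notMem ha, Finset.sum_insert ha]
    convert this using 1
    rw [transvection, Matrix.mul_add, Matrix.mul_one, Matrix.add_mul, Matrix.one_mul,
      Matrix.sum_mul]
    rw [Finset.sum_eq_zero (s := F) (f := fun i => single q i (s i) * single q a (s a))]
    · abel
    · intro i hi
      apply Matrix.single_mul_single_of_ne
      rintro rfl
      exact hq hi

lemma W.rowadd (q : ι) (s : ι → ℤ) (hs : s q = 0) :
    W (Fintype.card ι) (1 + vecMulVec (Pi.single q 1) s) := by
  have h := W.rowadd_aux q s (Finset.univ.erase q) (by simp)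
  convert W.mono h (Finset.card_le_univ _) using 1
  congr 1
  ext i j
  rw [Matrix.sum_apply]
  by_cases hi : i = q
  · subst hi
    by_cases hj : j = i
    · subst hj
      simp [vecMulVec_apply, hs, Matrix.single_apply]
    · simp [vecMulVec_apply, Matrix.single_apply, hj]
  · simp [vecMulVec_apply, Matrix.single_apply, hi, Ne.symm hi]

end basics

section reduction

lemma dirichlet (a b : ℤ) (ha : a ≠ 0) (h : IsCoprime b a) (N : ℕ) :
    ∃ p : ℕ, N < p ∧ p.Prime ∧ ∃ t : ℤ, (p : ℤ) = b + t * a := by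
  have h' : IsCoprime b (a.natAbs : ℤ) := by
    rw [Int.natCast_natAbs]
    exact (IsCoprime.abs_right_iff b a).2 h
  obtain ⟨p, hp, hpp, hm⟩ := Nat.forall_exists_prime_gt_and_zmodEq N
    (Int.natAbs_ne_zero.2 ha) h'
  refine ⟨p, hp, hpp, ?_⟩
  have h1 : (a.natAbs : ℤ) ∣ p - b := hm.symm.dvd
  rw [Int.natAbs_dvd] at h1
  obtain ⟨t, ht⟩ := h1
  exact ⟨t, by linear_combination ht⟩

lemma coprime_adjust (a b x : ℤ) (ha : a ≠ 0) (h : ∃ α β γ : ℤ, α * a + β * b + γ * x = 1) :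
    ∃ t : ℤ, IsCoprime a (b + t * x) := by
  obtain ⟨α, β, γ, h⟩ := h
  by_cases hx : x = 0
  · subst hx
    exact ⟨0, α, β, by linear_combination h⟩
  have hg : 0 < Int.gcd b x := Int.gcd_pos_of_ne_zero_right _ hx
  obtain ⟨b', x', hco, hb, hx'⟩ := Int.exists_gcd_one hg
  set g : ℤ := (Int.gcd b x : ℤ) with hgdef
  have hx0 : x' ≠ 0 := by
    rintro rfl
    simp at hx'
    exact hx hx'
  obtain ⟨p, hp, hpp, t, ht⟩ := dirichlet x' b' hx0 (Int.isCoprime_iff_gcd_eq_one.2 hco) a.natAbs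
  refine ⟨t, ?_⟩
  have e : b + t * x = (p : ℤ) * g := by
    rw [ht, hb, hx']; ring
  rw [e]
  refine IsCoprime.mul_right ?_ ?_
  · rw [isCoprime_comm, Prime.coprime_iff_not_dvd (Nat.prime_iff_prime_int.1 hpp)]
    intro hd
    have := Int.natAbs_dvd_natAbs.2 hd
    have := Nat.le_of_dvd (Int.natAbs_pos.2 ha) this
    simp at this
    omega
  · refine ⟨α, β * b' + γ * x', ?_⟩
    rw [hb, hx'] at h
    linear_combination h

variable {ι : Type*} [Fintype ι] [DecidableEq ι]

lemma rowadd_mulVec (q : ι) (s v : ι → ℤ) :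
    (1 + vecMulVec (Pi.single q 1) s) *ᵥ v = v + Pi.single q (s ⬝ᵥ v) := by
  rw [Matrix.add_mulVec, Matrix.one_mulVec]
  congr 1
  ext i
  by_cases hi : i = q
  · subst hi
    simp [Matrix.mulVec, vecMulVec_apply, dotProduct]
  · simp [Matrix.mulVec, vecMulVec_apply, dotProduct, hi]

lemma unimod_step {k : ℕ} {L : Matrix ι ι ℤ} (hL : W k L) {u v : ι → ℤ} (h : u ⬝ᵥ v = 1) :
    ∃ u' : ι → ℤ, u' ⬝ᵥ (L *ᵥ v) = 1 := by
  obtain ⟨L', _, h2, _⟩ := hL.exists_inv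
  refine ⟨u ᵥ* L', ?_⟩
  rw [← Matrix.dotProduct_mulVec, Matrix.mulVec_mulVec, h2, Matrix.one_mulVec, h]

lemma col_reduce {p q r : ι} (hpq : p ≠ q) (hpr : p ≠ r) (hqr : q ≠ r) (u v : ι → ℤ)
    (h : u ⬝ᵥ v = 1) :
    ∃ L : Matrix ι ι ℤ, W (3 * Fintype.card ι + 1) L ∧ L *ᵥ v = Pi.single r 1 := by
  -- step 0
  have h0 : ∃ L : Matrix ι ι ℤ, W 1 L ∧ (L *ᵥ v) p ≠ 0 := by
    by_cases hp : v p = 0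
    · have : ∃ i, v i ≠ 0 := by
        by_contra! hc
        have : v = 0 := funext hc
        simp [this] at h
      obtain ⟨i, hi⟩ := this
      have hip : p ≠ i := by rintro rfl; exact hi hp
      refine ⟨transvection p i 1, W.transv hip 1, ?_⟩
      have e : (Matrix.single p i (1 : ℤ) *ᵥ v) p = v i := by
        simp [Matrix.mulVec, dotProduct, Matrix.single_apply]
      rw [transvection, Matrix.add_mulVec, Matrix.one_mulVec, Pi.add_apply, hp, e]
      simpa using hi
    · exact ⟨1, W.one 1, by simpa using hp⟩
  obtain ⟨L0, hL0, hv0⟩ := h0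
  obtain ⟨u0, hu0⟩ := unimod_step hL0 h
  set v0 := L0 *ᵥ v with hv0def
  -- step 1
  set s : ι → ℤ := Function.update (Function.update u0 p 0) q 0 with hs
  have hsum : u0 p * v0 p + u0 q * v0 q + 1 * (s ⬝ᵥ v0) = 1 := by
    rw [one_mul]
    refine Eq.trans ?_ hu0
    have : u0 = s + Pi.single p (u0 p) + Pi.single q (u0 q) := by
      ext i
      by_cases hi : i = q
      · subst hi; simp [hs, hpq.symm]
      · by_cases hi' : i = p
        · subst hi'; simp [hs, hi]
        · simp [hs, hi, hi']
    conv_rhs => rw [this]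
    simp [add_dotProduct]
    ring
  obtain ⟨t, ht⟩ := coprime_adjust (v0 p) (v0 q) (s ⬝ᵥ v0) hv0 ⟨_, _, _, hsum⟩
  set L1 : Matrix ι ι ℤ := 1 + vecMulVec (Pi.single q 1) (t • s) with hL1def
  have hL1 : W (Fintype.card ι) L1 := W.rowadd q (t • s) (by simp [hs])
  set v1 := L1 *ᵥ v0 with hv1def
  have hv1 : v1 = v0 + Pi.single q (t * (s ⬝ᵥ v0)) := by
    rw [hv1def, hL1def, rowadd_mulVec, smul_dotProduct, smul_eq_mul]
  have hco : IsCoprime (v1 p) (v1 q) := by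
    rw [hv1]
    simpa [hpq] using ht
  obtain ⟨α, β, hαβ⟩ := hco
  -- step 2
  set s2 : ι → ℤ := Pi.single p ((1 - v1 r) * α) + Pi.single q ((1 - v1 r) * β) with hs2
  set L2 : Matrix ι ι ℤ := 1 + vecMulVec (Pi.single r 1) s2 with hL2def
  have hL2 : W (Fintype.card ι) L2 := W.rowadd r s2 (by simp [hs2, hpr.symm, hqr.symm])
  set v2 := L2 *ᵥ v1 with hv2def
  have hv2 : v2 r = 1 := by
    rw [hv2def, hL2def, rowadd_mulVec]
    simp [hs2, add_dotProduct]
    linear_combination (1 - v1 r) * hαβ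
  -- step 3
  set s3 : ι → ℤ := Function.update (-v2) r 0 with hs3
  set L3 : Matrix ι ι ℤ := (1 + vecMulVec (Pi.single r 1) s3)ᵀ with hL3def
  have hL3 : W (Fintype.card ι) L3 := (W.rowadd r s3 (by simp [hs3])).transpose
  have hv3 : L3 *ᵥ v2 = Pi.single r 1 := by
    rw [hL3def, transpose_add, transpose_one, Matrix.add_mulVec, Matrix.one_mulVec,
      transpose_vecMulVec]
    ext i
    by_cases hi : i = r
    · subst hi
      simp [Matrix.mulVec, vecMulVec_apply, hs3, hv2, dotProduct]
    · simp [Matrix.mulVec, vecMulVec_apply, hs3, hv2, dotProduct, hi, Pi.single_apply]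
  refine ⟨L3 * (L2 * (L1 * L0)), (hL3.mul (hL2.mul (hL1.mul hL0))).mono (by omega), ?_⟩
  rw [← Matrix.mulVec_mulVec, ← Matrix.mulVec_mulVec, ← Matrix.mulVec_mulVec]
  exact hv3

lemma block_reduce {p q r : ι} (hpq : p ≠ q) (hpr : p ≠ r) (hqr : q ≠ r) (M : Matrix ι ι ℤ)
    (hM : M.det = 1) :
    ∃ L R : Matrix ι ι ℤ, W (3 * Fintype.card ι + 1) L ∧ W (Fintype.card ι) R ∧
      (∀ i, i ≠ r → (L * M * R) i r = 0) ∧ (∀ i, i ≠ r → (L * M * R) r i = 0) ∧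
      (L * M * R) r r = 1 := by
  have hinv : M⁻¹ * M = 1 := Matrix.nonsing_inv_mul _ (by simp [hM])
  obtain ⟨L, hL, hLv⟩ := col_reduce hpq hpr hqr (fun i => M⁻¹ r i) (fun i => M i r) (by
    have := congrFun (congrFun hinv r) r
    simpa [Matrix.mul_apply, dotProduct] using this)
  have hcol : ∀ i, (L * M) i r = (Pi.single r 1 : ι → ℤ) i := by
    intro i
    rw [← hLv]
    rfl
  set N := L * M with hN
  set s : ι → ℤ := Function.update (fun i => - N r i) r 0 with hs
  refine ⟨L, 1 + vecMulVec (Pi.single r 1) s, hL, W.rowadd r s (by simp [hs]), ?_⟩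
  have key : ∀ i j, (N * (1 + vecMulVec (Pi.single r 1) s)) i j = N i j + N i r * s j := by
    intro i j
    rw [Matrix.mul_add, Matrix.mul_one, Matrix.add_apply, Matrix.mul_apply]
    simp [vecMulVec_apply, Pi.single_apply]
  refine ⟨?_, ?_, ?_⟩
  · intro i hi
    rw [key, hcol]; simp [hi]
  · intro i hi
    rw [key, hcol]; simp [hi, hs]
  · rw [key, hcol]; simp [hs]

lemma sum_reduce (n : ℕ) (hn : 2 ≤ n) (M : Matrix (Fin n ⊕ Fin 1) (Fin n ⊕ Fin 1) ℤ)
    (hM : M.det = 1) :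
    ∃ L R : Matrix (Fin n ⊕ Fin 1) (Fin n ⊕ Fin 1) ℤ, ∃ A : Matrix (Fin n) (Fin n) ℤ,
      W (3 * (n + 1) + 1) L ∧ W (n + 1) R ∧ A.det = 1 ∧ L * M * R = fromBlocks A 0 0 1 := by
  obtain ⟨L, R, hL, hR, h1, h2, h3⟩ := block_reduce (ι := Fin n ⊕ Fin 1)
    (p := Sum.inl ⟨0, by omega⟩) (q := Sum.inl ⟨1, by omega⟩) (r := Sum.inr 0)
    (by simp) (by simp) (by simp) M hM
  have e : L * M * R = fromBlocks (L * M * R).toBlocks₁₁ 0 0 1 := by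
    ext i j
    rcases i with i | i <;> rcases j with j | j
    · simp [toBlocks₁₁]
    · rw [Subsingleton.elim j 0, h1 _ (by simp)]; simp
    · rw [Subsingleton.elim i 0, h2 _ (by simp)]; simp
    · rw [Subsingleton.elim i 0, Subsingleton.elim j 0, h3]; simp
  refine ⟨L, R, _, by simpa using hL, by simpa using hR, ?_, e⟩
  have hd := congrArg Matrix.det e
  rw [det_fromBlocks_zero₂₁, Matrix.det_mul, Matrix.det_mul, hL.det, hR.det, hM] at hd
  simpa using hd.symm

end reduction

section three

/-- The block embedding of `2 × 2` matrices in `3 × 3` matrices. -/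
def emb (a b c d : ℤ) : Matrix (Fin 3) (Fin 3) ℤ := !![a, b, 0; c, d, 0; 0, 0, 1]

lemma t01 (t : ℤ) : transvection (0 : Fin 3) 1 t = !![1, t, 0; 0, 1, 0; 0, 0, 1] := by
  ext i j; fin_cases i <;> fin_cases j <;> simp [transvection, Matrix.single_apply]
lemma t10 (t : ℤ) : transvection (1 : Fin 3) 0 t = !![1, 0, 0; t, 1, 0; 0, 0, 1] := by
  ext i j; fin_cases i <;> fin_cases j <;> simp [transvection, Matrix.single_apply]
lemma t02 (t : ℤ) : transvection (0 : Fin 3) 2 t = !![1, 0, t; 0, 1, 0; 0, 0, 1] := by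
  ext i j; fin_cases i <;> fin_cases j <;> simp [transvection, Matrix.single_apply]
lemma t20 (t : ℤ) : transvection (2 : Fin 3) 0 t = !![1, 0, 0; 0, 1, 0; t, 0, 1] := by
  ext i j; fin_cases i <;> fin_cases j <;> simp [transvection, Matrix.single_apply]
lemma t21 (t : ℤ) : transvection (2 : Fin 3) 1 t = !![1, 0, 0; 0, 1, 0; 0, t, 1] := by
  ext i j; fin_cases i <;> fin_cases j <;> simp [transvection, Matrix.single_apply]
lemma t12 (t : ℤ) : transvection (1 : Fin 3) 2 t = !![1, 0, 0; 0, 1, t; 0, 0, 1] := by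
  ext i j; fin_cases i <;> fin_cases j <;> simp [transvection, Matrix.single_apply]

/-- Signed transposition. -/
def sw (i j : Fin 3) : Matrix (Fin 3) (Fin 3) ℤ :=
  transvection i j 1 * transvection j i (-1) * transvection i j 1

lemma W_sw {i j : Fin 3} (h : i ≠ j) : W 3 (sw i j) :=
  ((W.transv h 1).mul (W.transv h.symm (-1))).mul (W.transv h 1)

lemma sw02 : sw 0 2 = !![0, 0, 1; 0, 1, 0; -1, 0, 0] := by
  rw [sw, t02, t20]; simp [Matrix.mul_fin_three]
lemma sw01 : sw 0 1 = !![0, 1, 0; -1, 0, 0; 0, 0, 1] := by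
  rw [sw, t01, t10]; simp [Matrix.mul_fin_three]
lemma sw20 : sw 2 0 = !![0, 0, -1; 0, 1, 0; 1, 0, 0] := by
  rw [sw, t20, t02]; simp [Matrix.mul_fin_three]
lemma sw10 : sw 1 0 = !![0, -1, 0; 1, 0, 0; 0, 0, 1] := by
  rw [sw, t10, t01]; simp [Matrix.mul_fin_three]
lemma sw21 : sw 2 1 = !![1, 0, 0; 0, 0, -1; 0, 1, 0] := by
  rw [sw, t21, t12]; simp [Matrix.mul_fin_three]

lemma mat3_ext {a b c d e f g h i a' b' c' d' e' f' g' h' i' : ℤ} (h1 : a = a') (h2 : b = b')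
    (h3 : c = c') (h4 : d = d') (h5 : e = e') (h6 : f = f') (h7 : g = g') (h8 : h = h')
    (h9 : i = i') :
    !![a, b, c; d, e, f; g, h, i] = !![a', b', c'; d', e', f'; g', h', i'] := by
  subst_vars; rfl

lemma emb_row {k : ℕ} {a b c d c' d' : ℤ} (h : a * d - b * c = 1) (h' : a * d' - b * c' = 1)
    (hW : W k (emb a b c d)) : W (1 + k) (emb a b c' d') := by
  have : emb a b c' d' = transvection (1 : Fin 3) 0 (c' * d - d' * c) * emb a b c d := by
    rw [t10, emb, emb, Matrix.mul_fin_three]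
    apply mat3_ext <;> first | ring1 | skip
    · linear_combination (-c') * h + c * h'
    · linear_combination (-d') * h + d * h'
  rw [this]
  exact (W.transv (by decide) _).mul hW

/-- The row `(a, b)` can be completed only to matrices of bounded length. -/
def Bd (k : ℕ) (a b : ℤ) : Prop := ∀ c d : ℤ, a * d - b * c = 1 → W k (emb a b c d)

lemma W_neg : W 6 (emb (-1) 0 0 (-1)) := by
  have : emb (-1) 0 0 (-1) = sw 0 1 * sw 0 1 := by
    rw [sw01, emb]; simp [Matrix.mul_fin_three]
  rw [this]
  exact (W_sw (by decide)).mul (W_sw (by decide))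

lemma Bd_unit {ε e x : ℤ} (hε : ε = 1 ∨ ε = -1) (h : x ∣ e - ε) : Bd 9 e x := by
  intro c d hd
  obtain ⟨k, hk⟩ := h
  have he : e = ε + k * x := by linear_combination hk
  have hεε : ε * ε = 1 := by rcases hε with rfl | rfl <;> norm_num
  have h0 : W 6 (emb ε 0 0 ε) := by
    rcases hε with rfl | rfl
    · have : emb 1 0 0 1 = 1 := by
        ext i j; fin_cases i <;> fin_cases j <;> simp [emb]
      rw [this]; exact W.one 6
    · exact W_neg
  have key : emb e x c d = transvection (1 : Fin 3) 0 (ε * (c - k * d)) * emb ε 0 0 ε *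
      transvection (0 : Fin 3) 1 (ε * x) * transvection (1 : Fin 3) 0 k := by
    subst he
    rw [t10, t10, t01, emb, emb, Matrix.mul_fin_three, Matrix.mul_fin_three, Matrix.mul_fin_three]
    apply mat3_ext <;> first | ring1 | skip
    · linear_combination (-k * x) * hεε
    · linear_combination (-x) * hεε
    · rcases hε with rfl | rfl
      · linear_combination k * hd
      · linear_combination (-k) * hd
    · rcases hε with rfl | rfl
      · linear_combination hd
      · linear_combination (-1) * hd
  rw [key]
  exact (((W.transv (by decide) _).mul h0).mul (W.transv (by decide) _)).mul
    (W.transv (by decide) _)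

lemma Bd_mul {k l : ℕ} {a x y : ℤ} (hx : Bd k a x) (hy : Bd l a y) : Bd (k + l + 17) a (x * y) := by
  intro c d hd
  have h1 : W k (emb a x (y * c) d) := hx _ _ (by linear_combination hd)
  have h2 : W l (emb a y (x * c) d) := hy _ _ (by linear_combination hd)
  have h3 : W (1 + (k + l + 16)) (emb a (x * y) c d) := by
    refine emb_row (c := - (x * y * c * c)) (d := d * (1 - x * y * c)) ?_ hd ?_
    · linear_combination (1 - x * y * c) * hd
    have key : emb a (x * y) (- (x * y * c * c)) (d * (1 - x * y * c)) =
        sw 2 1 * (transvection (2 : Fin 3) 1 (x * c) *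
          (emb a x (y * c) d * (sw 2 0 * sw 1 0 * emb a y (x * c) d * sw 0 2) *
            transvection (0 : Fin 3) 2 (-x)) *
          transvection (2 : Fin 3) 0 (- (y * c)) * transvection (2 : Fin 3) 1 (- (d * y))) := by
      have hN : sw 2 0 * sw 1 0 * emb a y (x * c) d * sw 0 2 =
          !![1, 0, 0; 0, y, a; 0, -d, -(x * c)] := by
        rw [sw20, sw10, sw02, emb]
        simp [Matrix.mul_fin_three]
      have hR : emb a x (y * c) d * !![1, 0, 0; 0, y, a; 0, -d, -(x * c)] *
          transvection (0 : Fin 3) 2 (-x) =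
          !![a, x * y, 0; y * c, d * y, 1; 0, -d, -(x * c)] := by
        rw [t02, emb, Matrix.mul_fin_three, Matrix.mul_fin_three]
        apply mat3_ext <;> first | ring1 | skip
        linear_combination hd
      have hS : transvection (2 : Fin 3) 1 (x * c) *
          !![a, x * y, 0; y * c, d * y, 1; 0, -d, -(x * c)] =
          !![a, x * y, 0; y * c, d * y, 1; x * y * c * c, x * c * d * y - d, 0] := by
        rw [t21, Matrix.mul_fin_three]
        apply mat3_ext <;> ring1
      have hT : !![a, x * y, 0; y * c, d * y, 1; x * y * c * c, x * c * d * y - d, 0] *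
          transvection (2 : Fin 3) 0 (- (y * c)) =
          !![a, x * y, 0; 0, d * y, 1; x * y * c * c, x * c * d * y - d, 0] := by
        rw [t20, Matrix.mul_fin_three]
        apply mat3_ext <;> ring1
      have hU : !![a, x * y, 0; 0, d * y, 1; x * y * c * c, x * c * d * y - d, 0] *
          transvection (2 : Fin 3) 1 (- (d * y)) =
          !![a, x * y, 0; 0, 0, 1; x * y * c * c, x * c * d * y - d, 0] := by
        rw [t21, Matrix.mul_fin_three]
        apply mat3_ext <;> ring1
      rw [hN, hR, hS, hT, hU, sw21, emb, Matrix.mul_fin_three]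
      apply mat3_ext <;> ring1
    rw [key]
    refine W.mono ((W_sw (by decide)).mul ((((W.transv (by decide) _).mul
      ((h1.mul ((((W_sw (by decide)).mul (W_sw (by decide))).mul h2).mul
        (W_sw (by decide)))).mul (W.transv (by decide) _))).mul
        (W.transv (by decide) _)).mul (W.transv (by decide) _))) ?_
    omega
  exact h3.mono (by omega)

end three

section two

lemma emb_mul (a b c d a' b' c' d' : ℤ) : emb a b c d * emb a' b' c' d' =
    emb (a * a' + b * c') (a * b' + b * d') (c * a' + d * c') (c * b' + d * d') := by
  rw [emb, emb, emb, Matrix.mul_fin_three]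
  apply mat3_ext <;> ring1

lemma emb_one : emb 1 0 0 1 = 1 := by
  ext i j; fin_cases i <;> fin_cases j <;> simp [emb]

lemma emb_transpose (a b c d : ℤ) : (emb a b c d)ᵀ = emb a c b d := by
  ext i j; fin_cases i <;> fin_cases j <;> simp [emb]

lemma emb_pow {a b c d : ℤ} (h : a * d - b * c = 1) (m : ℕ) :
    ∃ f g r : ℤ, emb a b c d ^ m = emb (f + g * a) (g * b) (g * c) (f + g * d) ∧
      f + g * a = a ^ m + r * b ∧ f ^ 2 + f * g * (a + d) + g ^ 2 = 1 := by
  induction m with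
  | zero => exact ⟨1, 0, 0, by simp [emb_one], by simp, by simp⟩
  | succ m ih =>
    obtain ⟨f, g, r, h1, h2, h3⟩ := ih
    refine ⟨-g, f + g * (a + d), r * a + g * c, ?_, ?_, ?_⟩
    · rw [pow_succ, h1, emb_mul]
      congr 1
      · linear_combination (-g) * h
      · ring
      · ring
      · linear_combination (-g) * h
    · rw [pow_succ]
      linear_combination a * h2 + g * h
    · linear_combination h3

lemma pow_bd {a b c d ε : ℤ} (h : a * d - b * c = 1) (m : ℕ) (hε : ε = 1 ∨ ε = -1)
    (hm : b ∣ a ^ m - ε) : W 61 (emb a b c d ^ m) := by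
  obtain ⟨f, g, r, h1, h2, h3⟩ := emb_pow h m
  rw [h1]
  have hg : g ∣ (f - 1) * (f + 1) := ⟨-(f * (a + d) + g), by linear_combination h3⟩
  obtain ⟨g1, g2, hg1, hg2, rfl⟩ := exists_dvd_and_dvd_of_dvd_mul hg
  have b1 : Bd 9 (f + g1 * g2 * a) g1 := Bd_unit (ε := 1) (Or.inl rfl) (by
    have : f + g1 * g2 * a - 1 = (f - 1) + g1 * (g2 * a) := by ring
    rw [this]; exact dvd_add hg1 (dvd_mul_right _ _))
  have b2 : Bd 9 (f + g1 * g2 * a) g2 := Bd_unit (ε := -1) (Or.inr rfl) (by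
    have : f + g1 * g2 * a - -1 = (f + 1) + g2 * (g1 * a) := by ring
    rw [this]; exact dvd_add hg2 (dvd_mul_right _ _))
  have b3 : Bd 9 (f + g1 * g2 * a) b := Bd_unit hε (by
    have : f + g1 * g2 * a - ε = (a ^ m - ε) + b * r := by rw [h2]; ring
    rw [this]; exact dvd_add hm (dvd_mul_right _ _))
  exact Bd_mul (Bd_mul b1 b2) b3 _ _ (by linear_combination h3 + (g1 * g2) ^ 2 * h)

lemma pow_bd' {a b c d ε : ℤ} (h : a * d - b * c = 1) (m : ℕ) (hε : ε = 1 ∨ ε = -1)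
    (hm : c ∣ a ^ m - ε) : W 61 (emb a b c d ^ m) := by
  have := (pow_bd (a := a) (b := c) (c := b) (d := d) (by linear_combination h) m hε hm).transpose
  rwa [Matrix.transpose_pow, emb_transpose] at this

lemma euler {p : ℕ} (hp : p.Prime) {a : ℤ} (ha : ¬ (p : ℤ) ∣ a) (u : ℕ) :
    ∃ ε : ℤ, (ε = 1 ∨ ε = -1) ∧ (p : ℤ) ∣ a ^ (p / 2 * u) - ε := by
  haveI := Fact.mk hp
  have h0 : (a : ZMod p) ≠ 0 := by
    rwa [Ne, ZMod.intCast_zmod_eq_zero_iff_dvd]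
  have h1 := ZMod.pow_div_two_eq_neg_one_or_one p h0
  have : ∃ ε : ℤ, (ε = 1 ∨ ε = -1) ∧ (p : ℤ) ∣ a ^ (p / 2) - ε := by
    rcases h1 with h1 | h1
    · refine ⟨1, Or.inl rfl, ?_⟩
      rw [← ZMod.intCast_zmod_eq_zero_iff_dvd]
      push_cast
      rw [h1]; simp
    · refine ⟨-1, Or.inr rfl, ?_⟩
      rw [← ZMod.intCast_zmod_eq_zero_iff_dvd]
      push_cast
      rw [h1]; simp
  obtain ⟨ε, hε, hd⟩ := this
  refine ⟨ε ^ u, ?_, ?_⟩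
  · rcases hε with rfl | rfl
    · simp
    · exact neg_one_pow_eq_or ℤ u
  · rw [pow_mul]
    exact hd.trans (sub_dvd_pow_sub_pow _ _ u)

lemma good {a d : ℤ} {p q : ℕ} (hp : p.Prime) (hq : q.Prime) (hq3 : 3 < q)
    (hco : Nat.Coprime (p / 2) (q / 2)) (h : a * d - p * q = 1) : W 122 (emb a p q d) := by
  have hpa : ¬ (p : ℤ) ∣ a := by
    rintro ⟨t, rfl⟩
    have : (p : ℤ) ∣ 1 := ⟨t * d - q, by linear_combination -h⟩
    exact (Nat.prime_iff_prime_int.1 hp).not_dvd_one this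
  have hqa : ¬ (q : ℤ) ∣ a := by
    rintro ⟨t, rfl⟩
    have : (q : ℤ) ∣ 1 := ⟨t * d - p, by linear_combination -h⟩
    exact (Nat.prime_iff_prime_int.1 hq).not_dvd_one this
  obtain ⟨u, hu⟩ := Nat.exists_mul_mod_eq_one_of_coprime hco (by omega)
  have hv : p / 2 * u = q / 2 * (p / 2 * u / (q / 2)) + 1 := by
    have := Nat.div_add_mod (p / 2 * u) (q / 2)
    omega
  obtain ⟨ε, hε, h1⟩ := euler hp hpa u
  obtain ⟨ε', hε', h2⟩ := euler hq hqa (p / 2 * u / (q / 2))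
  have w1 := pow_bd h _ hε h1
  have w2 := pow_bd' h _ hε' h2
  rw [hv, pow_succ] at w1
  exact w2.of_mul_left w1

lemma sl2_odd {a b c d : ℤ} (h : a * d - b * c = 1) (ha : Odd a) : W 124 (emb a b c d) := by
  obtain ⟨a0, ha0⟩ := ha
  have ha' : a ≠ 0 := by omega
  -- choose the prime `p`
  have hr : ∃ r w v : ℤ, r = b + a * w ∧ r = 3 + 4 * v := by
    have : IsCoprime a 4 := by
      have h2 : IsCoprime a 2 := ⟨1, -a0, by rw [ha0]; ring⟩
      have := h2.mul_right h2
      norm_num at this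
      exact this
    obtain ⟨x, y, hxy⟩ := this
    exact ⟨b + a * (x * (3 - b)), x * (3 - b), -y * (3 - b), rfl, by
      linear_combination (3 - b) * hxy⟩
  obtain ⟨r, w, v, hr1, hr2⟩ := hr
  have hcop : IsCoprime r (4 * a) := by
    refine IsCoprime.mul_right ⟨-1, 1 + v, by rw [hr2]; ring⟩ ⟨-c, d + w * c, ?_⟩
    rw [hr1]; linear_combination h
  obtain ⟨p, hp3, hp, t, ht⟩ := dirichlet (4 * a) r (by omega) hcop 3
  obtain ⟨s, hs⟩ : ∃ s : ℤ, (p : ℤ) = b + s * a := ⟨w + 4 * t, by rw [ht, hr1]; ring⟩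
  obtain ⟨v', hv'⟩ : ∃ v' : ℤ, (p : ℤ) = 3 + 4 * v' := ⟨v + t * a, by rw [ht, hr2]; ring⟩
  have hpmod : p % 4 = 3 := by omega
  set d1 := d + s * c with hd1
  have hdet1 : a * d1 - p * c = 1 := by rw [hs, hd1]; linear_combination h
  -- choose the prime `q`
  set k := p / 2 with hk
  have hpk : (p : ℤ) = 2 * k + 1 := by omega
  have hk0 : (k : ℤ) ≠ 0 := by omega
  set r2 := c - d1 * a with hr2def
  have hr2k : r2 = -1 - 2 * k * c := by
    rw [hr2def]; rw [hpk] at hdet1; linear_combination -hdet1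
  have hcop2 : IsCoprime r2 (a * k) := by
    refine IsCoprime.mul_right ⟨-p, d1 - p * d1, ?_⟩ ⟨-1, -2 * c, by rw [hr2k]; ring⟩
    rw [hr2def]; linear_combination hdet1
  obtain ⟨q, hq3, hq, t2, ht2⟩ := dirichlet (a * k) r2 (mul_ne_zero ha' hk0) hcop2 3
  obtain ⟨s2, hs2⟩ : ∃ s2 : ℤ, (q : ℤ) = c + s2 * a := ⟨-d1 + t2 * k, by rw [ht2, hr2def]; ring⟩
  set d2 := d1 + s2 * p with hd2
  have hdet2 : a * d2 - p * q = 1 := by rw [hs2, hd2]; linear_combination hdet1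
  have hqodd : q % 2 = 1 := by
    rcases hq.eq_two_or_odd with h | h <;> omega
  have hco : Nat.Coprime (p / 2) (q / 2) := by
    rw [← hk]
    have hd1 : k ∣ q + 1 := by
      have : (k : ℤ) ∣ ((q + 1 : ℕ) : ℤ) := ⟨-2 * c + t2 * a, by
        push_cast; rw [ht2, hr2k]; ring⟩
      exact_mod_cast this
    have e : q + 1 = q / 2 * 2 + 2 := by omega
    have hg1 : Nat.gcd k (q / 2) ∣ 2 := by
      have h1 : Nat.gcd k (q / 2) ∣ q / 2 * 2 + 2 := e ▸ (Nat.gcd_dvd_left _ _).trans hd1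
      exact (Nat.dvd_add_right ((Nat.gcd_dvd_right k (q / 2)).mul_right 2)).1 h1
    rcases (Nat.dvd_prime Nat.prime_two).1 hg1 with h | h
    · exact h
    · exfalso
      have : 2 ∣ k := h ▸ Nat.gcd_dvd_left k (q / 2)
      omega
  have w := good hp hq hq3 hco hdet2
  have e1 : emb a p q d2 = transvection (1 : Fin 3) 0 s2 * emb a p c d1 := by
    rw [t10, emb, emb, Matrix.mul_fin_three, hd2, hs2]
    apply mat3_ext <;> ring1
  have e2 : emb a p c d1 = emb a b c d * transvection (0 : Fin 3) 1 s := by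
    rw [t01, emb, emb, Matrix.mul_fin_three, hd1, hs]
    apply mat3_ext <;> ring1
  rw [e1] at w
  have w1 := (W.transv (by decide) _).of_mul_left w
  rw [e2] at w1
  exact ((W.transv (by decide) _).of_mul_right w1)

lemma sl2 {a b c d : ℤ} (h : a * d - b * c = 1) : W 125 (emb a b c d) := by
  by_cases ha : Odd a
  · exact (sl2_odd h ha).mono (by norm_num)
  · have hb : Odd b := by
      rw [Int.not_odd_iff_even] at ha
      by_contra hb
      rw [Int.not_odd_iff_even] at hb
      obtain ⟨x, rfl⟩ := ha
      obtain ⟨y, rfl⟩ := hb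
      have : 2 * (x * d - y * c) = 1 := by linear_combination h
      omega
    have hodd : Odd (a + b) := (Int.not_odd_iff_even.1 ha).add_odd hb
    have w := sl2_odd (a := a + b) (b := b) (c := c + d) (d := d) (by linear_combination h) hodd
    have e : emb (a + b) b (c + d) d = emb a b c d * transvection (1 : Fin 3) 0 1 := by
      rw [t10, emb, emb, Matrix.mul_fin_three]
      apply mat3_ext <;> ring1
    rw [e] at w
    exact (W.transv (by decide) _).of_mul_right w

/-- Bounded generation (Carter–Keller). -/
theorem bounded_generation (n : ℕ) (hn : 3 ≤ n) :
    ∃ N : ℕ, ∀ M : Matrix (Fin n) (Fin n) ℤ, M.det = 1 → W N M := by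
  have step : ∀ (n K : ℕ), 2 ≤ n →
      (∀ A : Matrix (Fin n) (Fin n) ℤ, A.det = 1 →
        W K (reindexAlgEquiv ℤ ℤ finSumFinEquiv (fromBlocks A 0 0 (1 : Matrix (Fin 1) (Fin 1) ℤ)))) →
      ∃ N : ℕ, ∀ M : Matrix (Fin (n + 1)) (Fin (n + 1)) ℤ, M.det = 1 → W N M := by
    intro n K hn hA
    refine ⟨3 * (n + 1) + 1 + (K + (n + 1)), fun M hM => ?_⟩
    set e : Fin n ⊕ Fin 1 ≃ Fin (n + 1) := finSumFinEquiv with he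
    obtain ⟨L, R, A, hL, hR, hdA, heq⟩ := sum_reduce n hn (reindexAlgEquiv ℤ ℤ e.symm M)
      (by rw [Matrix.det_reindexAlgEquiv]; exact hM)
    have h1 := hA A hdA
    rw [← heq, map_mul, map_mul] at h1
    have h2 : reindexAlgEquiv ℤ ℤ e (reindexAlgEquiv ℤ ℤ e.symm M) = M := by
      ext i j; simp
    rw [h2] at h1
    have h3 := (hR.reindex e).of_mul_right h1
    exact (hL.reindex e).of_mul_left h3
  induction n, hn using Nat.le_induction with
  | base =>
    refine step 2 125 le_rfl fun A hA => ?_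
    rw [Matrix.det_fin_two] at hA
    convert sl2 hA using 1
    ext i j
    fin_cases i <;> fin_cases j <;> rfl
  | succ n hn ih =>
    obtain ⟨N, hN⟩ := ih
    exact step n N (by omega) fun A hA => ((hN A hA).sumInl).reindex _

end two

section cat0

open Filter Topology

lemma exists_midpoint {X : Type*} [MetricSpace X] [CAT0Space X] (y z : X) :
    ∃ m : X, dist y m = dist y z / 2 ∧ dist z m = dist y z / 2 := by
  obtain ⟨γ, h0, h1, h⟩ := CAT0Space.geodesic y z
  refine ⟨γ (1 / 2), ?_, ?_⟩
  · have := h 0 (by norm_num) (1 / 2) (by norm_num)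
    rw [h0] at this
    rw [this, show |(0 : ℝ) - 1 / 2| = 1 / 2 by norm_num [abs_of_neg]]
    ring
  · have := h 1 (by norm_num) (1 / 2) (by norm_num)
    rw [h1] at this
    rw [this, show |(1 : ℝ) - 1 / 2| = 1 / 2 by norm_num [abs_of_pos]]
    ring

/-- Bruhat–Tits fixed point theorem. -/
theorem fixed_of_bounded {G X : Type*} [Group G] [MetricSpace X] [CompleteSpace X] [CAT0Space X]
    [MulAction G X] (hiso : ∀ g : G, Isometry (fun x : X => g • x)) (x0 : X) (B : ℝ)
    (hB : ∀ g : G, dist (g • x0) x0 ≤ B) : ∃ x : X, ∀ g : G, g • x = x := by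
  set r : X → ℝ := fun x => ⨆ g : G, dist (g • x0) x with hr
  have hbdd : ∀ x, BddAbove (Set.range fun g : G => dist (g • x0) x) := by
    intro x
    refine ⟨B + dist x0 x, ?_⟩
    rintro _ ⟨g, rfl⟩
    exact (dist_triangle _ x0 _).trans (by simpa using hB g)
  have hle : ∀ g x, dist (g • x0) x ≤ r x := fun g x => le_ciSup (hbdd x) g
  have hr0 : ∀ x, 0 ≤ r x := fun x => dist_nonneg.trans (hle 1 x)
  have hrle : ∀ x C, (∀ g : G, dist (g • x0) x ≤ C) → r x ≤ C := fun x C h => ciSup_le h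
  have hinv : ∀ (h : G) x, r (h • x) ≤ r x := by
    intro h x
    refine hrle _ _ fun g => ?_
    have e : dist (g • x0) (h • x) = dist ((h⁻¹ * g) • x0) x := by
      rw [← (hiso h).dist_eq ((h⁻¹ * g) • x0) x]
      simp [smul_smul]
    rw [e]
    exact hle _ _
  have hlip : ∀ x y, r x ≤ r y + dist y x := fun x y =>
    hrle _ _ fun g => (dist_triangle _ y _).trans (by gcongr; exact hle g y)
  haveI : Nonempty X := ⟨x0⟩
  set ρ : ℝ := ⨅ x, r x with hρ
  have hρb : BddBelow (Set.range r) := ⟨0, by rintro _ ⟨x, rfl⟩; exact hr0 x⟩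
  have hρle : ∀ x, ρ ≤ r x := fun x => ciInf_le hρb x
  have hρ0 : 0 ≤ ρ := le_ciInf hr0
  have hcn : ∀ y z, dist y z ^ 2 ≤ 2 * (r y ^ 2 + r z ^ 2) - 4 * ρ ^ 2 := by
    intro y z
    obtain ⟨m, h1, h2⟩ := exists_midpoint y z
    set Q := (r y ^ 2 + r z ^ 2) / 2 - dist y z ^ 2 / 4 with hQ
    have hg : ∀ g : G, dist (g • x0) m ^ 2 ≤ Q := by
      intro g
      have a1 := CAT0Space.cn (g • x0) y z m h1 h2
      have a2 : dist (g • x0) y ^ 2 ≤ r y ^ 2 := pow_le_pow_left₀ dist_nonneg (hle g y) 2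
      have a3 : dist (g • x0) z ^ 2 ≤ r z ^ 2 := pow_le_pow_left₀ dist_nonneg (hle g z) 2
      rw [hQ]; linarith
    have hQ0 : 0 ≤ Q := (sq_nonneg _).trans (hg 1)
    have hm : r m ≤ √Q := hrle _ _ fun g => Real.le_sqrt_of_sq_le (hg g)
    have h3 : ρ ^ 2 ≤ Q := by
      calc ρ ^ 2 ≤ (√Q) ^ 2 := pow_le_pow_left₀ hρ0 ((hρle m).trans hm) 2
        _ = Q := Real.sq_sqrt hQ0
    rw [hQ] at h3
    linarith
  have hseq : ∀ n : ℕ, ∃ y, r y < ρ + 1 / ((n : ℝ) + 1) := fun n =>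
    exists_lt_of_ciInf_lt (by have : (0 : ℝ) < 1 / ((n : ℝ) + 1) := by positivity
                              linarith)
  choose y hy using hseq
  have hy2 : ∀ N n : ℕ, N ≤ n → r (y n) ^ 2 ≤ ρ ^ 2 + (2 * ρ + 1) * (1 / ((N : ℝ) + 1)) := by
    intro N n hNn
    have e1 : 1 / ((n : ℝ) + 1) ≤ 1 / ((N : ℝ) + 1) := by gcongr
    have e2 : 1 / ((N : ℝ) + 1) ≤ 1 := by
      rw [div_le_one (by positivity)]
      have : (0 : ℝ) ≤ N := by positivity
      linarith
    have e0 : 0 ≤ 1 / ((N : ℝ) + 1) := by positivity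
    have e3 : r (y n) ≤ ρ + 1 / ((N : ℝ) + 1) := by linarith [hy n]
    have e4 := pow_le_pow_left₀ (hr0 (y n)) e3 2
    nlinarith
  have htend : Tendsto (fun N : ℕ => √(4 * (2 * ρ + 1) * (1 / ((N : ℝ) + 1)))) atTop (𝓝 0) := by
    have h1 := (tendsto_one_div_add_atTop_nhds_zero_nat (𝕜 := ℝ)).const_mul (4 * (2 * ρ + 1))
    have h2 := h1.sqrt
    simpa using h2
  have hcau : CauchySeq y := by
    refine cauchySeq_of_le_tendsto_0 _ (fun n m N hn hm => ?_) htend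
    apply Real.le_sqrt_of_sq_le
    have := hcn (y n) (y m)
    have := hy2 N n hn
    have := hy2 N m hm
    linarith
  obtain ⟨x, hx⟩ := cauchySeq_tendsto_of_complete hcau
  have hrx : r x ≤ ρ := by
    have t1 : Tendsto (fun n : ℕ => ρ + 1 / ((n : ℝ) + 1) + dist (y n) x) atTop (𝓝 (ρ + 0 + 0)) :=
      (tendsto_const_nhds.add tendsto_one_div_add_atTop_nhds_zero_nat).add
        (tendsto_iff_dist_tendsto_zero.1 hx)
    have := ge_of_tendsto' t1 (fun n => (hlip x (y n)).trans (by linarith [hy n]))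
    simpa using this
  refine ⟨x, fun g => ?_⟩
  have h1 := hcn (g • x) x
  have h2 : r (g • x) ≤ ρ := (hinv g x).trans hrx
  have h3 := pow_le_pow_left₀ (hr0 _) h2 2
  have h4 := pow_le_pow_left₀ (hr0 _) hrx 2
  have h5 : dist (g • x) x ^ 2 ≤ 0 := by linarith
  have h6 : dist (g • x) x = 0 := by
    have := sq_nonneg (dist (g • x) x)
    exact pow_eq_zero_iff (two_ne_zero) |>.1 (le_antisymm h5 this)
  exact dist_eq_zero.1 h6

end cat0

section final

/-- Transvections as elements of `SL`. -/
def tv {n : ℕ} (i j : Fin n) (h : i ≠ j) (c : ℤ) : Matrix.SpecialLinearGroup (Fin n) ℤ :=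
  ⟨transvection i j c, det_transvection_of_ne i j h c⟩

lemma tv_add {n : ℕ} (i j : Fin n) (h : i ≠ j) (c d : ℤ) :
    tv i j h (c + d) = tv i j h c * tv i j h d := by
  apply Subtype.ext
  exact (transvection_mul_transvection_same i j h c d).symm

lemma tv_fix {n : ℕ} {X : Type*} [MulAction (Matrix.SpecialLinearGroup (Fin n) ℤ) X]
    (i j : Fin n) (h : i ≠ j) (y : X) (hy : tv i j h 1 • y = y) (c : ℤ) : tv i j h c • y = y := by
  induction c using Int.induction_on with
  | zero =>
    have : tv i j h 0 = 1 := Subtype.ext (by simp [tv])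
    rw [this, one_smul]
  | succ c ih => rw [tv_add, mul_smul, hy, ih]
  | pred c ih =>
    have e : tv i j h (-(c : ℤ)) = tv i j h (-(c : ℤ) - 1) * tv i j h 1 := by
      rw [← tv_add]; congr 1; ring
    rw [e, mul_smul, hy] at ih
    exact ih

lemma tv_conj {n : ℕ} (hn : 3 ≤ n) (i j k l : Fin n) (h : i ≠ j) (h' : k ≠ l) :
    ∃ g : Matrix.SpecialLinearGroup (Fin n) ℤ, g * tv i j h 1 = tv k l h' 1 * g := by
  obtain ⟨τ, hk, hl⟩ : ∃ τ : Equiv.Perm (Fin n), τ k = i ∧ τ l = j := by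
    refine ⟨Equiv.swap (Equiv.swap k i l) j * Equiv.swap k i, ?_, ?_⟩
    · rw [Equiv.Perm.mul_apply, Equiv.swap_apply_left]
      apply Equiv.swap_apply_of_ne_of_ne _ h
      intro e
      have := congrArg (Equiv.swap k i) e
      simp at this
      exact h' this
    · simp
  obtain ⟨m, hmk, hml⟩ : ∃ m : Fin n, m ≠ k ∧ m ≠ l := by
    have : ∃ m, m ∉ ({k, l} : Finset (Fin n)) := by
      by_contra! hc
      have h1 : (Finset.univ : Finset (Fin n)) ⊆ {k, l} := fun x _ => hc x
      have h2 := Finset.card_le_card h1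
      have h3 := Finset.card_le_two (a := k) (b := l)
      simp at h2
      omega
    obtain ⟨m, hm⟩ := this
    simp at hm
    exact ⟨m, hm.1, hm.2⟩
  set δ : Fin n → ℤ := Function.update 1 m (Equiv.Perm.sign τ : ℤ) with hδ
  have hδk : δ k = 1 := by simp [hδ, hmk.symm]
  have hδl : δ l = 1 := by simp [hδ, hml.symm]
  have hdet : (diagonal δ * τ.permMatrix ℤ).det = 1 := by
    rw [Matrix.det_mul, Matrix.det_diagonal, Matrix.det_permutation, hδ,
      Finset.prod_update_of_mem (Finset.mem_univ m)]
    rcases Int.units_eq_one_or (Equiv.Perm.sign τ) with e | e <;> simp [e]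
  refine ⟨⟨diagonal δ * τ.permMatrix ℤ, hdet⟩, Subtype.ext ?_⟩
  show diagonal δ * τ.permMatrix ℤ * transvection i j 1 =
    transvection k l 1 * (diagonal δ * τ.permMatrix ℤ)
  set g := diagonal δ * τ.permMatrix ℤ with hg
  have ge : ∀ a b, g a b = if τ a = b then δ a else 0 := by
    intro a b
    rw [hg, Matrix.diagonal_mul]
    simp [Equiv.Perm.permMatrix, PEquiv.toMatrix_apply, eq_comm]
  rw [transvection, transvection, Matrix.mul_add, Matrix.add_mul, Matrix.mul_one, Matrix.one_mul]
  congr 1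
  ext a b
  have hτ : τ a = i ↔ a = k := by rw [← hk]; exact τ.injective.eq_iff
  by_cases hb : b = j
  · subst hb
    by_cases ha : a = k
    · subst ha
      simp [ge, hk, hl, hδk, hδl]
    · simp [ge, ha, hτ]
  · by_cases ha : a = k
    · subst ha
      simp [ge, hl, hb, Ne.symm hb]
    · simp [ha, hb]

end final

end SLBG

/-- For n ≥ 3, if SL(n, ℤ) acts by isometries on a complete CAT(0) space and some elementary
matrix has a fixed point, then the whole group has a fixed point. -/
theorem sl_fixed_point_of_elementary (n : ℕ) (hn : 3 ≤ n)
    {X : Type*} [MetricSpace X] [CompleteSpace X] [CAT0Space X]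
    [MulAction (Matrix.SpecialLinearGroup (Fin n) ℤ) X]
    (hiso : ∀ g : Matrix.SpecialLinearGroup (Fin n) ℤ, Isometry (fun x : X => g • x))
    (hfix : ∃ (i j : Fin n) (h : i ≠ j) (x : X), elemMat i j h • x = x) :
    ∃ x : X, ∀ g : Matrix.SpecialLinearGroup (Fin n) ℤ, g • x = x := by
  obtain ⟨i, j, hij, x, hx⟩ := hfix
  have hall : ∀ (k l : Fin n) (h : k ≠ l), ∃ y : X, ∀ c : ℤ, SLBG.tv k l h c • y = y := by
    intro k l h
    obtain ⟨g, hg⟩ := SLBG.tv_conj hn i j k l hij h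
    refine ⟨g • x, fun c => SLBG.tv_fix k l h _ ?_ c⟩
    rw [← mul_smul, ← hg, mul_smul]
    congr 1
  have hC : ∃ C : ℝ, 0 ≤ C ∧ ∀ (k l : Fin n) (h : k ≠ l) (c : ℤ),
      dist (SLBG.tv k l h c • x) x ≤ C := by
    have h1 : ∀ p : Fin n × Fin n, ∃ C : ℝ, 0 ≤ C ∧ ∀ (h : p.1 ≠ p.2) (c : ℤ),
        dist (SLBG.tv p.1 p.2 h c • x) x ≤ C := by
      rintro ⟨k, l⟩
      by_cases h : k = l
      · exact ⟨0, le_rfl, fun h' => absurd h h'⟩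
      · obtain ⟨y, hy⟩ := hall k l h
        refine ⟨2 * dist x y, by positivity, fun _ c => ?_⟩
        have e : dist (SLBG.tv k l h c • x) y = dist x y := by
          conv_lhs => rw [← hy c]
          exact (hiso _).dist_eq x y
        have := dist_triangle (SLBG.tv k l h c • x) y x
        rw [e, dist_comm y x] at this
        linarith
    choose C hC0 hC using h1
    refine ⟨∑ p, C p, Finset.sum_nonneg fun p _ => hC0 p, fun k l h c => ?_⟩
    exact (hC (k, l) h c).trans (Finset.single_le_sum (f := C) (fun p _ => hC0 p)
      (Finset.mem_univ (k, l)))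
  obtain ⟨C, hC0, hC⟩ := hC
  obtain ⟨N, hN⟩ := SLBG.bounded_generation n hn
  have hlist : ∀ (L : List (Matrix.TransvectionStruct (Fin n) ℤ))
      (g : Matrix.SpecialLinearGroup (Fin n) ℤ),
      (g : Matrix (Fin n) (Fin n) ℤ) = (L.map Matrix.TransvectionStruct.toMatrix).prod →
      dist (g • x) x ≤ L.length * C := by
    intro L
    induction L with
    | nil =>
      intro g hg
      have : g = 1 := Subtype.ext (by simpa using hg)
      simp [this]
    | cons t L ih =>
      intro g hg
      set g' : Matrix.SpecialLinearGroup (Fin n) ℤ :=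
        ⟨(L.map Matrix.TransvectionStruct.toMatrix).prod, by simp⟩ with hg'
      have e : g = SLBG.tv t.i t.j t.hij t.c * g' := by
        apply Subtype.ext
        rw [hg, List.map_cons, List.prod_cons]
        rfl
      have h1 := ih g' rfl
      have h2 := hC t.i t.j t.hij t.c
      have h3 := dist_triangle (g • x) (SLBG.tv t.i t.j t.hij t.c • x) x
      have h4 : dist (g • x) (SLBG.tv t.i t.j t.hij t.c • x) = dist (g' • x) x := by
        rw [e, mul_smul]
        exact (hiso _).dist_eq _ _
      rw [h4] at h3
      push_cast [List.length_cons]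
      linarith
  refine SLBG.fixed_of_bounded hiso x (N * C) fun g => ?_
  obtain ⟨L, hL, hg⟩ := hN g g.2
  refine (hlist L g hg).trans ?_
  gcongr
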